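/- arXiv:2211.11477 — 3 statements merged into one kernel-verified Lean document; each statement's English description precedes it below -/
import Mathlib

section
/- If the polynomial P^{I,J}_{α,β,γ}(X) has no roots in F_{q^n} and max{I, J} ≤ (n−1)/2, then the F_q-subspace U^{I,J,n}_{α,β,γ} of F_{q^n}^4 is cutting: for every 3-dimensional F_{q^n}-subspace H of F_{q^n}^4, the F_{q^n}-span of H ∩ U^{I,J,n}_{α,β,γ} equals H. -/
open Module

namespace ScatteredSeq

variable (q : ℕ) (Fq : Type*) [Field Fq] [Fintype Fq] {Fqn : Type*} [Field Fqn]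
  [Algebra Fq Fqn]

theorem frob_add (hq : Fintype.card Fq = q) (t : ℕ) (a b : Fqn) :
    (a + b) ^ q ^ t = a ^ q ^ t + b ^ q ^ t := by
  obtain ⟨p, hp⟩ := CharP.exists Fq
  haveI : CharP Fqn p := charP_of_injective_algebraMap (algebraMap Fq Fqn).injective p
  obtain ⟨k, hprime, hcard⟩ := FiniteField.card Fq p
  haveI : Fact p.Prime := ⟨hprime⟩
  subst hq
  rw [hcard, ← pow_mul]
  exact add_pow_char_pow a b p _

theorem frob_algebraMap (hq : Fintype.card Fq = q) (t : ℕ) (c : Fq) :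
    (algebraMap Fq Fqn c) ^ q ^ t = algebraMap Fq Fqn c := by
  rw [← map_pow]
  congr 1
  subst hq
  exact FiniteField.pow_card_pow t c

/-- The vector `(x, y, x^{q^I} + α y^{q^J}, x^{q^J} + β y^{q^I} + γ y^{q^J})`. -/
def Uvec (α β γ : Fqn) (I J : ℕ) (x y : Fqn) : Fin 4 → Fqn :=
  ![x, y, x ^ q ^ I + α * y ^ q ^ J, x ^ q ^ J + β * y ^ q ^ I + γ * y ^ q ^ J]

/-- The `F_q`-subspace `U^{I,J,n}_{α,β,γ}` of `F_{q^n}^4`. -/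
def Uspace (hq : Fintype.card Fq = q) (α β γ : Fqn) (I J : ℕ) :
    Submodule Fq (Fin 4 → Fqn) where
  carrier := {w | ∃ x y : Fqn, w = Uvec q α β γ I J x y}
  zero_mem' := by
    have hq0 : q ≠ 0 := by subst hq; exact Fintype.card_ne_zero
    exact ⟨0, 0, by funext i; fin_cases i <;>
      simp [Uvec, zero_pow (pow_ne_zero _ hq0)]⟩
  add_mem' := by
    rintro a b ⟨x₁, y₁, rfl⟩ ⟨x₂, y₂, rfl⟩
    refine ⟨x₁ + x₂, y₁ + y₂, ?_⟩
    funext i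
    fin_cases i <;>
      simp [Uvec, frob_add q Fq hq, mul_add] <;> ring
  smul_mem' := by
    rintro c w ⟨x, y, rfl⟩
    refine ⟨c • x, c • y, ?_⟩
    funext i
    fin_cases i <;>
      simp [Uvec, Algebra.smul_def, mul_pow, frob_algebraMap q Fq hq] <;> ring

/-- An `F_q`-subspace of `F_{q^n}^k` is scattered if it meets every `F_{q^n}`-line in
an `F_q`-subspace of dimension at most `1`. -/
def IsScattered {k : ℕ} (U : Submodule Fq (Fin k → Fqn)) : Prop :=
  ∀ H : Submodule Fqn (Fin k → Fqn), finrank Fqn H = 1 →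
    finrank Fq ↥(U ⊓ H.restrictScalars Fq) ≤ 1

/-- The polynomial `P^{I,J}_{α,β,γ}` has no roots in `F_{q^n}`. -/
def PHasNoRoot (α β γ : Fqn) (I J : ℕ) : Prop :=
  if I < J then ∀ x : Fqn, x ^ (q ^ (J - I) + 1) + γ * x - α * β ≠ 0
  else ∀ x : Fqn, x ^ (q ^ (I - J) + 1) + γ * x ^ q ^ (I - J) - α * β ≠ 0

end ScatteredSeq

namespace ScatteredSeq

section

variable (K : Type*) {L : Type*} [Field K] [Fintype K] [Field L] [Algebra K L]

/-- The `K`-linear map `x ↦ x ^ |K| ^ k` on a field extension of the finite field `K`. -/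
def frobPow (k : ℕ) : L →ₗ[K] L := (FiniteField.frobeniusAlgHom K L ^ k).toLinearMap

theorem frobPow_apply (k : ℕ) (x : L) : frobPow K k x = x ^ Fintype.card K ^ k := by
  simp [frobPow, AlgHom.coe_pow, FiniteField.coe_frobeniusAlgHom, pow_iterate]

theorem pow_card_pow_sum {ι : Type*} (s : Finset ι) (f : ι → L) (k : ℕ) :
    (∑ i ∈ s, f i) ^ Fintype.card K ^ k = ∑ i ∈ s, f i ^ Fintype.card K ^ k := by
  simp only [← frobPow_apply, map_sum]

theorem pow_card_pow_finrank [FiniteDimensional K L] (x : L) :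
    x ^ Fintype.card K ^ finrank K L = x := by
  have : Finite L := Module.finite_of_finite K
  have := Fintype.ofFinite L
  rw [← Module.card_eq_pow_finrank, FiniteField.pow_card]

theorem sum_trace_smul_eq_zero [FiniteDimensional K L] {ι : Type*} [Fintype ι] (c x : ι → L)
    (h : ∀ j, ∑ i, c i * x i ^ Fintype.card K ^ j = 0) :
    ∑ i, Algebra.trace K L (c i) • x i = 0 := by
  have : Finite L := Module.finite_of_finite K
  simp only [Algebra.smul_def, FiniteField.algebraMap_trace_eq_sum_pow, Nat.card_eq_fintype_card,
    Finset.sum_mul]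
  rw [Finset.sum_comm]
  refine Finset.sum_eq_zero fun k hk => ?_
  have hk : k < finrank K L := by simpa using hk
  have h1 := congrArg (· ^ Fintype.card K ^ k) (h (finrank K L - k))
  simp only [pow_card_pow_sum, mul_pow, ← pow_mul, ← pow_add, Nat.sub_add_cancel hk.le,
    pow_card_pow_finrank] at h1
  simpa using h1

theorem eq_zero_of_trace_mul_eq_zero [FiniteDimensional K L] (a : L)
    (h : ∀ b, Algebra.trace K L (b * a) = 0) : a = 0 := by
  have : Finite L := Module.finite_of_finite K
  exact (traceForm_nondegenerate K L).2 a h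

/-- The solution space of a bivariate linear recurrence of order `m` for the Frobenius. -/
theorem finrank_le_two_mul_of_recurrence [FiniteDimensional K L] (W : Submodule K (L × L))
    {k m : ℕ} (hk : k < m) (a b : Fin 4 → L)
    (ha : ∀ w ∈ W, w.1 ^ Fintype.card K ^ m = a 0 * w.1 + a 1 * w.2 +
      a 2 * w.1 ^ Fintype.card K ^ k + a 3 * w.2 ^ Fintype.card K ^ k)
    (hb : ∀ w ∈ W, w.2 ^ Fintype.card K ^ m = b 0 * w.1 + b 1 * w.2 +
      b 2 * w.1 ^ Fintype.card K ^ k + b 3 * w.2 ^ Fintype.card K ^ k) :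
    finrank K W ≤ 2 * m := by
  let B := Module.finBasis K W
  let v : Fin (finrank K W) → Fin m → L × L := fun i j =>
    ((B i).1.1 ^ Fintype.card K ^ (j : ℕ), (B i).1.2 ^ Fintype.card K ^ (j : ℕ))
  have hv : LinearIndependent L v := by
    rw [Fintype.linearIndependent_iff]
    intro c hc
    have key : ∀ j, (∑ i, c i * (B i).1.1 ^ Fintype.card K ^ j = 0) ∧
        (∑ i, c i * (B i).1.2 ^ Fintype.card K ^ j = 0) := by
      intro j
      induction j using Nat.strong_induction_on with
      | _ j ih =>
        by_cases hj : j < m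
        · have := congrFun hc ⟨j, hj⟩
          constructor
          · simpa [v, Prod.fst_sum] using congrArg Prod.fst this
          · simpa [v, Prod.snd_sum] using congrArg Prod.snd this
        · obtain ⟨t, rfl⟩ := Nat.exists_eq_add_of_le (not_lt.mp hj)
          have h0 := ih t (by omega)
          have h1 := ih (k + t) (by omega)
          have step : ∀ (d : Fin 4 → L) (y : Fin (finrank K W) → L),
              (∀ i, y i = d 0 * (B i).1.1 + d 1 * (B i).1.2 +
                d 2 * (B i).1.1 ^ Fintype.card K ^ k + d 3 * (B i).1.2 ^ Fintype.card K ^ k) →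
              ∑ i, c i * y i ^ Fintype.card K ^ t = 0 := by
            intro d y hy
            have : ∀ i, c i * y i ^ Fintype.card K ^ t =
                d 0 ^ Fintype.card K ^ t * (c i * (B i).1.1 ^ Fintype.card K ^ t) +
                d 1 ^ Fintype.card K ^ t * (c i * (B i).1.2 ^ Fintype.card K ^ t) +
                d 2 ^ Fintype.card K ^ t * (c i * (B i).1.1 ^ Fintype.card K ^ (k + t)) +
                d 3 ^ Fintype.card K ^ t * (c i * (B i).1.2 ^ Fintype.card K ^ (k + t)) := by
              intro i
              rw [hy i]
              simp only [frob_add _ K rfl, mul_pow, ← pow_mul, ← pow_add]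
              ring
            simp only [this, Finset.sum_add_distrib, ← Finset.mul_sum, h0.1, h0.2, h1.1, h1.2]
            simp
          constructor
          · simpa only [← pow_mul, ← pow_add] using step a _ fun i => ha _ (B i).2
          · simpa only [← pow_mul, ← pow_add] using step b _ fun i => hb _ (B i).2
    intro i
    refine eq_zero_of_trace_mul_eq_zero K _ fun l => ?_
    refine Fintype.linearIndependent_iff.mp B.linearIndependent
      (fun i => Algebra.trace K L (l * c i)) ?_ i
    apply Subtype.ext
    apply Prod.ext
    · simpa [Prod.fst_sum] using sum_trace_smul_eq_zero K (fun i => l * c i) (fun i => (B i).1.1)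
        fun j => by simp only [mul_assoc, ← Finset.mul_sum, (key j).1, mul_zero]
    · simpa [Prod.snd_sum] using sum_trace_smul_eq_zero K (fun i => l * c i) (fun i => (B i).1.2)
        fun j => by simp only [mul_assoc, ← Finset.mul_sum, (key j).2, mul_zero]
  have := hv.fintype_card_le_finrank
  simp [Module.finrank_pi_fintype] at this
  omega

theorem finrank_le_of_linearized [FiniteDimensional K L] (V : Submodule K L) {i j m : ℕ}
    (hi : 0 < i) (hj : 0 < j) (hij : i ≠ j) (him : i ≤ m) (hjm : j ≤ m) (a b c : L)
    (hne : a ≠ 0 ∨ b ≠ 0 ∨ c ≠ 0)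
    (h : ∀ t ∈ V, a * t + b * t ^ Fintype.card K ^ i + c * t ^ Fintype.card K ^ j = 0) :
    finrank K V ≤ m := by
  classical
  have hq : 1 < Fintype.card K := Fintype.one_lt_card
  have hone : ∀ {k : ℕ}, 0 < k → Fintype.card K ^ k ≠ 1 := fun hk =>
    (Nat.one_lt_pow hk.ne' hq).ne'
  have hinj : Fintype.card K ^ i ≠ Fintype.card K ^ j := fun e =>
    hij (Nat.pow_right_injective hq e)
  let p : Polynomial L := Polynomial.C a * Polynomial.X + Polynomial.C b *
    Polynomial.X ^ Fintype.card K ^ i + Polynomial.C c * Polynomial.X ^ Fintype.card K ^ j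
  have hp : p ≠ 0 := by
    intro hp
    have h1 := congrArg (Polynomial.coeff · 1) hp
    have h2 := congrArg (Polynomial.coeff · (Fintype.card K ^ i)) hp
    have h3 := congrArg (Polynomial.coeff · (Fintype.card K ^ j)) hp
    simp [p, Polynomial.coeff_X, Polynomial.coeff_X_pow, (hone hi).symm,
      (hone hj).symm, hinj, hinj.symm] at h1 h2 h3
    tauto
  have hdeg : p.natDegree ≤ Fintype.card K ^ m := by
    have hi' : Fintype.card K ^ i ≤ Fintype.card K ^ m := Nat.pow_le_pow_right hq.le him
    have hj' : Fintype.card K ^ j ≤ Fintype.card K ^ m := Nat.pow_le_pow_right hq.le hjm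
    refine Polynomial.natDegree_add_le_of_degree_le (Polynomial.natDegree_add_le_of_degree_le
      ((Polynomial.natDegree_C_mul_le a Polynomial.X |>.trans Polynomial.natDegree_X_le).trans (Nat.one_le_pow _ _ hq.le)) ?_) ?_
    · exact (Polynomial.natDegree_C_mul_X_pow_le _ _).trans hi'
    · exact (Polynomial.natDegree_C_mul_X_pow_le _ _).trans hj'
  have : Finite L := Module.finite_of_finite K
  have := Fintype.ofFinite V
  have hcard : Fintype.card V ≤ p.roots.toFinset.card := by
    rw [← Finset.card_univ]
    refine Finset.card_le_card_of_injOn (fun t => (t : L)) (fun t _ => ?_)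
      Subtype.val_injective.injOn
    simpa [p, hp] using h t.1 t.2
  have h4 := hcard.trans ((Multiset.toFinset_card_le _).trans ((Polynomial.card_roots' p).trans hdeg))
  rw [Module.card_eq_pow_finrank (K := K)] at h4
  exact (Nat.pow_le_pow_iff_right hq).mp h4

theorem PHasNoRoot.pow_mul_pow_ne {q : ℕ} {α β γ : L} {I J : ℕ} (hP : PHasNoRoot q α β γ I J)
    (x : L) : x ^ q ^ I * x ^ q ^ J + γ * x ^ q ^ I - α * β ≠ 0 := by
  unfold PHasNoRoot at hP
  split_ifs at hP with h
  · have := hP (x ^ q ^ I)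
    rwa [pow_succ, ← pow_mul, ← pow_add q, Nat.add_sub_cancel' h.le, mul_comm (x ^ q ^ J)] at this
  · have := hP (x ^ q ^ J)
    rwa [pow_succ, ← pow_mul, ← pow_add q, Nat.add_sub_cancel' (not_lt.mp h)] at this

theorem PHasNoRoot.eq_zero_of_leading_coeffs {q : ℕ} {α β γ : L} {I J : ℕ}
    (hP : PHasNoRoot q α β γ I J) {u v c d : L} (huv : u ≠ 0 ∨ v ≠ 0)
    (h1 : c * u ^ q ^ I + d * β * v ^ q ^ I = 0)
    (h2 : c * α * v ^ q ^ J + d * (u ^ q ^ J + γ * v ^ q ^ J) = 0) (hq : q ≠ 0) :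
    c = 0 ∧ d = 0 := by
  have hz : ∀ k, (0 : L) ^ q ^ k = 0 := fun k => zero_pow (pow_ne_zero _ hq)
  by_cases hv : v = 0
  · subst hv
    have hu : u ≠ 0 := by simpa using huv
    simpa [hz, hu] using And.intro h1 h2
  · have hdet : u ^ q ^ I * (u ^ q ^ J + γ * v ^ q ^ J) - α * β * (v ^ q ^ I * v ^ q ^ J) ≠ 0 := by
      have h := mul_ne_zero (hP.pow_mul_pow_ne (u / v))
        (mul_ne_zero (pow_ne_zero (q ^ I) hv) (pow_ne_zero (q ^ J) hv))
      convert h using 1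
      simp only [div_pow]
      field_simp
    constructor <;> refine (mul_eq_zero.mp ?_).resolve_right hdet
    · linear_combination (u ^ q ^ J + γ * v ^ q ^ J) * h1 - β * v ^ q ^ I * h2
    · linear_combination u ^ q ^ I * h2 - α * v ^ q ^ J * h1

theorem dotProduct_Uvec (q : ℕ) (α β γ : L) (I J : ℕ) (f : Fin 4 → L) (x y : L) :
    f ⬝ᵥ Uvec q α β γ I J x y = f 0 * x + f 1 * y + f 2 * (x ^ q ^ I + α * y ^ q ^ J) +
      f 3 * (x ^ q ^ J + β * y ^ q ^ I + γ * y ^ q ^ J) := by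
  simp [dotProduct, Fin.sum_univ_four, Uvec]

variable [FiniteDimensional K L] {α β γ : L} {I J : ℕ} (W : Submodule K (L × L))
  {f g : Fin 4 → L}

theorem finrank_le_of_degenerate_relation (hI : 0 < I) (hJ : 0 < J) (hIJ : I ≠ J)
    (hP : PHasNoRoot (Fintype.card K) α β γ I J) (hfg : LinearIndependent L ![f, g])
    (hf : ∀ w ∈ W, f ⬝ᵥ Uvec (Fintype.card K) α β γ I J w.1 w.2 = 0)
    (hg : ∀ w ∈ W, g ⬝ᵥ Uvec (Fintype.card K) α β γ I J w.1 w.2 = 0)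
    (hg2 : g 2 = 0) (hg3 : g 3 = 0) : finrank K W ≤ max I J := by
  have hind := LinearIndependent.pair_iff.mp hfg
  have hg01 : g 1 ≠ 0 ∨ -g 0 ≠ 0 := by
    by_contra! h
    have hg0 : g = 0 := by
      funext i
      fin_cases i
      exacts [by simpa using h.2, h.1, hg2, hg3]
    simpa [hg0] using hind 0 1
  let φ : L →ₗ[K] L × L := (LinearMap.mulLeft K (g 1)).prod (LinearMap.mulLeft K (-g 0))
  have hW : W ≤ LinearMap.range φ := by
    rintro ⟨x, y⟩ hw
    have h := hg _ hw
    simp only [dotProduct_Uvec, hg2, hg3, zero_mul, add_zero] at h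
    rcases hg01 with h1 | h0
    · refine ⟨x / g 1, Prod.ext ?_ ?_⟩
      · simp [φ]
        field_simp
      · simp [φ]
        field_simp
        linear_combination -h
    · have h0' : g 0 ≠ 0 := by simpa using h0
      refine ⟨-y / g 0, Prod.ext ?_ ?_⟩
      · simp [φ]
        field_simp
        linear_combination -h
      · simp [φ]
        field_simp
  rw [← Submodule.map_comap_eq_of_le hW]
  refine (Submodule.finrank_map_le _ _).trans ?_
  refine finrank_le_of_linearized K _ hI hJ hIJ (le_max_left _ _) (le_max_right _ _)
    (f 0 * g 1 + f 1 * -g 0)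
    (f 2 * g 1 ^ Fintype.card K ^ I + f 3 * β * (-g 0) ^ Fintype.card K ^ I)
    (f 2 * α * (-g 0) ^ Fintype.card K ^ J +
      f 3 * (g 1 ^ Fintype.card K ^ J + γ * (-g 0) ^ Fintype.card K ^ J)) ?_ ?_
  · by_contra! h
    obtain ⟨ha, hb, hc⟩ := h
    obtain ⟨h2, h3⟩ := hP.eq_zero_of_leading_coeffs hg01 hb hc Fintype.card_ne_zero
    have e1 := (hind (g 1) (-f 1) (by
      funext i
      fin_cases i <;> simp [h2, h3, hg2, hg3]
      · linear_combination ha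
      · ring)).1
    have e0 := (hind (g 0) (-f 0) (by
      funext i
      fin_cases i <;> simp [h2, h3, hg2, hg3]
      · ring
      · linear_combination -ha)).1
    simp [e0, e1] at hg01
  · intro t ht
    have h := hf _ ht
    simp only [dotProduct_Uvec, φ, LinearMap.prod_apply, Function.prod, LinearMap.mulLeft_apply,
      mul_pow] at h
    linear_combination h

theorem finrank_le_of_nondegenerate_relations (hα : α ≠ 0) (hβ : β ≠ 0) (hIJ : I ≠ J)
    (hf : ∀ w ∈ W, f ⬝ᵥ Uvec (Fintype.card K) α β γ I J w.1 w.2 = 0)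
    (hg : ∀ w ∈ W, g ⬝ᵥ Uvec (Fintype.card K) α β γ I J w.1 w.2 = 0)
    (hdet : f 2 * g 3 - f 3 * g 2 ≠ 0) : finrank K W ≤ 2 * max I J := by
  obtain ⟨D, hD⟩ := exists_eq_mul_right_of_dvd (hdet.isUnit.dvd (a := 1))
  let p : Fin 2 → L := ![-D * (g 3 * f 0 - f 3 * g 0), -D * (g 3 * f 1 - f 3 * g 1)]
  let r : Fin 2 → L := ![-D * (f 2 * g 0 - g 2 * f 0), -D * (f 2 * g 1 - g 2 * f 1)]
  have h1 : ∀ w ∈ W, w.1 ^ Fintype.card K ^ I + α * w.2 ^ Fintype.card K ^ J =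
      p 0 * w.1 + p 1 * w.2 := by
    intro w hw
    have hf := hf w hw
    have hg := hg w hw
    rw [dotProduct_Uvec] at hf hg
    simp [p]
    linear_combination D * g 3 * hf - D * f 3 * hg +
      (w.1 ^ Fintype.card K ^ I + α * w.2 ^ Fintype.card K ^ J) * hD
  have h2 : ∀ w ∈ W, w.1 ^ Fintype.card K ^ J + β * w.2 ^ Fintype.card K ^ I +
      γ * w.2 ^ Fintype.card K ^ J = r 0 * w.1 + r 1 * w.2 := by
    intro w hw
    have hf := hf w hw
    have hg := hg w hw
    rw [dotProduct_Uvec] at hf hg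
    simp [r]
    linear_combination D * f 2 * hg - D * g 2 * hf +
      (w.1 ^ Fintype.card K ^ J + β * w.2 ^ Fintype.card K ^ I +
        γ * w.2 ^ Fintype.card K ^ J) * hD
  rcases hIJ.lt_or_gt with h | h
  · rw [max_eq_right h.le]
    refine finrank_le_two_mul_of_recurrence K W h
      ![r 0 - γ * α⁻¹ * p 0, r 1 - γ * α⁻¹ * p 1, γ * α⁻¹, -β]
      ![α⁻¹ * p 0, α⁻¹ * p 1, -α⁻¹, 0] (fun w hw => ?_) (fun w hw => ?_)
    · simp
      field_simp
      linear_combination α * h2 w hw - γ * h1 w hw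
    · simp
      field_simp
      linear_combination h1 w hw
  · rw [max_eq_left h.le]
    refine finrank_le_two_mul_of_recurrence K W h
      ![p 0, p 1, 0, -α]
      ![β⁻¹ * r 0, β⁻¹ * r 1, -β⁻¹, -β⁻¹ * γ] (fun w hw => ?_) (fun w hw => ?_)
    · simp
      linear_combination h1 w hw
    · simp
      field_simp
      linear_combination h2 w hw

theorem finrank_le_of_two_relations (hα : α ≠ 0) (hβ : β ≠ 0) (hI : 0 < I) (hJ : 0 < J)
    (hIJ : I ≠ J) (hP : PHasNoRoot (Fintype.card K) α β γ I J)
    (hfg : LinearIndependent L ![f, g])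
    (hf : ∀ w ∈ W, f ⬝ᵥ Uvec (Fintype.card K) α β γ I J w.1 w.2 = 0)
    (hg : ∀ w ∈ W, g ⬝ᵥ Uvec (Fintype.card K) α β γ I J w.1 w.2 = 0) :
    finrank K W ≤ 2 * max I J := by
  by_cases hdet : f 2 * g 3 - f 3 * g 2 = 0
  swap
  · exact finrank_le_of_nondegenerate_relations K W hα hβ hIJ hf hg hdet
  have hind := LinearIndependent.pair_iff.mp hfg
  suffices finrank K W ≤ max I J by omega
  by_cases h : f 2 = 0 ∧ f 3 = 0
  · refine finrank_le_of_degenerate_relation K W hI hJ hIJ hP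
      (LinearIndependent.pair_iff.mpr fun s t hst => ?_) hg hf h.1 h.2
    exact (hind t s (by rwa [add_comm])).symm
  · obtain ⟨a, b, ha, h2, h3⟩ : ∃ a b : L, a ≠ 0 ∧ a * g 2 - b * f 2 = 0 ∧
        a * g 3 - b * f 3 = 0 := by
      by_cases hf2 : f 2 = 0
      · exact ⟨f 3, g 3, fun h3 => h ⟨hf2, h3⟩, by linear_combination -hdet, by ring⟩
      · exact ⟨f 2, g 2, hf2, by ring, by linear_combination hdet⟩
    refine finrank_le_of_degenerate_relation K W (g := a • g - b • f) hI hJ hIJ hP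
      (LinearIndependent.pair_iff.mpr fun s t hst => ?_) hf (fun w hw => ?_)
      (by simpa using h2) (by simpa using h3)
    · have := hind (s - t * b) (t * a) (by
        rw [← hst]
        module)
      have ht : t = 0 := (mul_eq_zero.mp this.2).resolve_right ha
      exact ⟨by simpa [ht] using this.1, ht⟩
    · rw [sub_dotProduct, smul_dotProduct, smul_dotProduct, hf w hw, hg w hw]
      simp

/-- The parametrization of `Uspace` by `L × L`. -/
def Umap (α β γ : L) (I J : ℕ) : L × L →ₗ[K] Fin 4 → L where
  toFun w := Uvec (Fintype.card K) α β γ I J w.1 w.2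
  map_add' v w := by
    funext i
    fin_cases i <;> simp [Uvec, frob_add _ K rfl] <;> ring
  map_smul' c w := by
    funext i
    fin_cases i <;>
      simp [Uvec, Algebra.smul_def, mul_pow, frob_algebraMap _ K rfl] <;> ring

theorem finrank_le_finrank_comap_hyperplane (T : L × L →ₗ[K] Fin 4 → L)
    (H : Submodule L (Fin 4 → L)) (hH : finrank L H = 3) :
    finrank K L ≤ finrank K ((H.restrictScalars K).comap T) := by
  have hquot : finrank L ((Fin 4 → L) ⧸ H) = 1 := by
    have := H.finrank_quotient_add_finrank
    simp [hH] at this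
    omega
  have := FiniteDimensional.trans K L ((Fin 4 → L) ⧸ H)
  let ψ : L × L →ₗ[K] (Fin 4 → L) ⧸ H := (H.mkQ.restrictScalars K) ∘ₗ T
  have hker : LinearMap.ker ψ = (H.restrictScalars K).comap T := by
    ext w
    simp [ψ]
  have h1 := ψ.finrank_range_add_finrank_ker
  have h2 := (LinearMap.range ψ).finrank_le
  have h3 := finrank_mul_finrank K L ((Fin 4 → L) ⧸ H)
  rw [hquot] at h3
  rw [hker, finrank_prod] at h1
  omega

end

theorem exists_linearIndependent_pair_dotProduct_eq_zero {L : Type*} [Field L] {m : ℕ}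
    (S : Submodule L (Fin m → L)) (hS : finrank L S + 2 ≤ m) :
    ∃ f g : Fin m → L, LinearIndependent L ![f, g] ∧
      (∀ w ∈ S, f ⬝ᵥ w = 0) ∧ ∀ w ∈ S, g ⬝ᵥ w = 0 := by
  have hann := Subspace.finrank_add_finrank_dualAnnihilator_eq S
  rw [Module.finrank_fin_fun] at hann
  obtain ⟨v, hv⟩ := exists_linearIndependent_of_le_finrank
    (R := L) (M := S.dualAnnihilator) (n := 2) (by omega)
  obtain ⟨e, he⟩ : ∃ e : Dual L (Fin m → L) ≃ₗ[L] (Fin m → L), ∀ φ w, e φ ⬝ᵥ w = φ w :=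
    ⟨(dotProductEquiv L (Fin m)).symm,
      fun φ w => LinearMap.congr_fun ((dotProductEquiv L (Fin m)).apply_symm_apply φ) w⟩
  have hv' : LinearIndependent L fun i => (v i : Dual L (Fin m → L)) :=
    LinearIndependent.map_injOn hv S.dualAnnihilator.subtype Subtype.val_injective.injOn
  let u : Fin 2 → Fin m → L := fun i => e (v i)
  have hu : LinearIndependent L u := hv'.map' e.toLinearMap e.ker
  have h0 : ∀ i, ∀ w ∈ S, u i ⬝ᵥ w = 0 := fun i w hw =>
    (he _ w).trans ((Submodule.mem_dualAnnihilator _).mp (v i).2 w hw)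
  refine ⟨u 0, u 1, ?_, h0 0, h0 1⟩
  have : ![u 0, u 1] = u := by
    funext i
    fin_cases i <;> rfl
  rwa [this]

end ScatteredSeq

open ScatteredSeq Module

/-- If P^{I,J}_{α,β,γ}(X) has no roots in F_{q^n} and
max{I,J} ≤ (n−1)/2, then U^{I,J,n}_{α,β,γ} is cutting: for every 3-dimensional
F_{q^n}-subspace (hyperplane) H of F_{q^n}^4, the F_{q^n}-span of H ∩ U equals H. -/
theorem Uspace_cutting
    (q n : ℕ) (Fq Fqn : Type*) [Field Fq] [Fintype Fq] [Field Fqn] [Algebra Fq Fqn]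
    (hq : Fintype.card Fq = q) (hrank : Module.finrank Fq Fqn = n)
    (α β γ : Fqn) (hα : α ≠ 0) (hβ : β ≠ 0) (hγ : γ ≠ 0)
    (I J : ℕ) (hI : 0 < I) (hJ : 0 < J) (hIJ : I ≠ J) (hIn : I < n - 1) (hJn : J < n - 1)
    (hP : PHasNoRoot q α β γ I J)
    (hmax : 2 * max I J ≤ n - 1) :
    ∀ H : Submodule Fqn (Fin 4 → Fqn), Module.finrank Fqn H = 3 →
      Submodule.span Fqn ((H : Set (Fin 4 → Fqn)) ∩ (Uspace q Fq hq α β γ I J : Set (Fin 4 → Fqn))) = H := by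
  subst hq hrank
  intro H hH
  have : FiniteDimensional Fq Fqn := FiniteDimensional.of_finrank_pos (by omega)
  set S := Submodule.span Fqn ((H : Set (Fin 4 → Fqn)) ∩
    (Uspace (Fintype.card Fq) Fq rfl α β γ I J : Set (Fin 4 → Fqn))) with hS
  have hSH : S ≤ H := Submodule.span_le.mpr Set.inter_subset_left
  by_contra hne
  have hlt := Submodule.finrank_lt_finrank_of_lt (lt_of_le_of_ne hSH hne)
  obtain ⟨f, g, hind, hf, hg⟩ := exists_linearIndependent_pair_dotProduct_eq_zero S (by omega)
  let W := (H.restrictScalars Fq).comap (Umap Fq α β γ I J)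
  have hW : ∀ w ∈ W, Uvec (Fintype.card Fq) α β γ I J w.1 w.2 ∈ S := fun w hw =>
    Submodule.subset_span ⟨hw, w.1, w.2, rfl⟩
  have hle := finrank_le_of_two_relations Fq W hα hβ hI hJ hIJ hP hind
    (fun w hw => hf _ (hW w hw)) (fun w hw => hg _ (hW w hw))
  have hge := finrank_le_finrank_comap_hyperplane Fq (Umap Fq α β γ I J) H hH
  change _ ≤ finrank Fq W at hge
  omega
end

section
/- Assume gcd(I, J, n) = 1, that the polynomial P^{I,J}_{α,β,γ}(X) has no roots in F_{q^n}, and that max{I, J} ≤ (n−1)/2. Then the F_q-subspace U := U^{I,J,n}_{α,β,γ} of F_{q^n}^4 is scattered and indecomposable: there do not exist nonzero F_{q^n}-subspaces V_1, V_2 of F_{q^n}^4 with F_{q^n}^4 = V_1 ⊕ V_2, U = (U ∩ V_1) + (U ∩ V_2), and with dim_{F_q}(U ∩ V_1) and dim_{F_q}(U ∩ V_2) both positive multiples of n. -/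
open Module

namespace ScatteredSeq

open Matrix Polynomial

variable (q : ℕ) (Fq : Type*) [Field Fq] [Fintype Fq] {Fqn : Type*} [Field Fqn]
  [Algebra Fq Fqn]

/-- The `q^t`-power Frobenius as a ring homomorphism. -/
def frobHom (hq : Fintype.card Fq = q) (t : ℕ) : Fqn →+* Fqn where
  toFun x := x ^ q ^ t
  map_one' := one_pow _
  map_mul' a b := mul_pow a b _
  map_zero' := zero_pow (pow_ne_zero _ (hq ▸ Fintype.card_ne_zero))
  map_add' := frob_add q Fq hq t

/-- The `q^t`-power Frobenius applied coordinatewise. -/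
def frobVec {m : Type*} (t : ℕ) (u : m → Fqn) : m → Fqn := fun i => u i ^ q ^ t

section frobVec

variable {m : Type*} (t : ℕ)

theorem frobVec_add (hq : Fintype.card Fq = q) (u v : m → Fqn) :
    frobVec q t (u + v) = frobVec q t u + frobVec q t v :=
  funext fun _ => frob_add q Fq hq t _ _

theorem frobVec_mulVec [Fintype m] (hq : Fintype.card Fq = q) (M : Matrix m m Fqn)
    (u : m → Fqn) :
    frobVec q t (M *ᵥ u) = M.map (frobHom q Fq hq t) *ᵥ frobVec q t u :=
  funext fun i => RingHom.map_mulVec (frobHom q Fq hq t) M u i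

theorem frobVec_frobVec (s : ℕ) (u : m → Fqn) :
    frobVec q t (frobVec q s u) = frobVec q (t + s) u := by
  funext i
  simp only [frobVec, ← pow_mul, ← pow_add, add_comm]

theorem frobVec_zero (hq : Fintype.card Fq = q) : frobVec q t (0 : m → Fqn) = 0 :=
  funext fun _ => map_zero (frobHom q Fq hq t)

theorem frobVec_zero_exp (u : m → Fqn) : frobVec q 0 u = u := by
  funext i
  simp [frobVec]

end frobVec

theorem map_frobHom_eq_zero {m : Type*} (hq : Fintype.card Fq = q) (t : ℕ)
    {M : Matrix m m Fqn} (h : M.map (frobHom q Fq hq t) = 0) : M = 0 := by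
  ext i j
  exact (map_eq_zero (frobHom q Fq hq t)).1 (congrFun (congrFun h i) j)

/-- A `q`-polynomial of `q`-degree less than `n` vanishing on `F_{q^n}` has zero coefficients. -/
theorem sum_coeff_eq_zero [FiniteDimensional Fq Fqn] (hq : Fintype.card Fq = q)
    {ι : Type*} [Fintype ι] (e : ι → ℕ) (he : ∀ i, e i < finrank Fq Fqn) (c : ι → Fqn)
    (h : ∀ x : Fqn, ∑ i, c i * x ^ q ^ e i = 0) (k : ℕ) :
    ∑ i, (Pi.single (e i) (c i) : ℕ → Fqn) k = 0 := by
  have hq1 : 1 < q := hq ▸ Fintype.one_lt_card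
  have : Finite Fqn := Module.finite_of_finite Fq
  have := Fintype.ofFinite Fqn
  have hcard : Fintype.card Fqn = q ^ finrank Fq Fqn := by
    rw [Module.card_eq_pow_finrank (K := Fq), hq]
  let p : Fqn[X] := ∑ i, C (c i) * X ^ q ^ e i
  have hp : p = 0 := by
    refine eq_zero_of_natDegree_lt_card_of_eval_eq_zero p Function.injective_id
      (fun x => by simpa [p, eval_finsetSum] using h x) ?_
    rw [hcard]
    refine lt_of_le_of_lt (natDegree_sum_le_of_forall_le (n := q ^ (finrank Fq Fqn - 1)) _ _
      fun i _ => (natDegree_C_mul_X_pow_le _ _).trans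
        (Nat.pow_le_pow_right hq1.le (Nat.le_sub_one_of_lt (he i))))
      (Nat.pow_lt_pow_right hq1 (Nat.sub_one_lt Module.finrank_pos.ne'))
  have hk := congrArg (fun r => coeff r (q ^ k)) hp
  simpa [p, finsetSum_coeff, coeff_X_pow, (Nat.pow_right_injective hq1).eq_iff, Pi.single_apply]
    using hk

theorem sum_matrix_coeff_eq_zero [FiniteDimensional Fq Fqn] (hq : Fintype.card Fq = q)
    {ι m : Type*} [Fintype ι] [Fintype m] [DecidableEq m] (e : ι → ℕ)
    (he : ∀ i, e i < finrank Fq Fqn) (C : ι → Matrix m m Fqn)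
    (h : ∀ u : m → Fqn, ∑ i, C i *ᵥ frobVec q (e i) u = 0) (k : ℕ) :
    ∑ i, (Pi.single (e i) (C i) : ℕ → Matrix m m Fqn) k = 0 := by
  ext a b
  have hsingle : ∀ (t : ℕ) (x : Fqn),
      frobVec q t (Pi.single b x : m → Fqn) = Pi.single b (x ^ q ^ t) := fun t x => by
    funext j
    exact Pi.apply_single (M := fun _ => Fqn) (N := fun _ => Fqn) (fun _ y => y ^ q ^ t)
      (fun _ => map_zero (frobHom q Fq hq t)) b x j
  have := sum_coeff_eq_zero q Fq hq e he (fun i => C i a b) (fun x => by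
    simpa [hsingle, Finset.sum_apply, mul_comm] using congrFun (h (Pi.single b x)) a) k
  rw [Matrix.sum_apply]
  simpa [Pi.single_apply, apply_ite (fun M : Matrix m m Fqn => M a b)] using this

theorem mem_range_algebraMap_of_pow_eq [FiniteDimensional Fq Fqn] (hq : Fintype.card Fq = q)
    {x : Fqn} (hx : x ^ q = x) : ∃ c : Fq, algebraMap Fq Fqn c = x := by
  have : Finite Fqn := Module.finite_of_finite Fq
  have := (IsGalois.mem_range_algebraMap_iff_fixed (F := Fq) x).2 fun f => by
    obtain ⟨k, rfl⟩ := (FiniteField.bijective_frobeniusAlgEquivOfAlgebraic_pow Fq Fqn).2 f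
    rw [AlgEquiv.coe_pow, FiniteField.coe_frobeniusAlgEquivOfAlgebraic, hq]
    exact Function.iterate_fixed hx k
  exact this

theorem mem_range_algebraMap_of_gcd [FiniteDimensional Fq Fqn] (hq : Fintype.card Fq = q)
    {I J : ℕ} (hgcd : Nat.gcd (Nat.gcd I J) (finrank Fq Fqn) = 1) {x : Fqn}
    (hxI : x ^ q ^ I = x) (hxJ : x ^ q ^ J = x) : ∃ c : Fq, algebraMap Fq Fqn c = x := by
  have : Finite Fqn := Module.finite_of_finite Fq
  have := Fintype.ofFinite Fqn
  have hper : ∀ t : ℕ, x ^ q ^ t = x → Function.IsPeriodicPt (fun y : Fqn => y ^ q) t x :=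
    fun t ht => by
      rw [Function.IsPeriodicPt, Function.IsFixedPt, pow_iterate]
      exact ht
  have hn : x ^ q ^ finrank Fq Fqn = x := by
    rw [← hq, ← Module.card_eq_pow_finrank (K := Fq) (V := Fqn), FiniteField.pow_card]
  have := ((hper I hxI).gcd (hper J hxJ)).gcd (hper _ hn)
  rw [hgcd] at this
  exact mem_range_algebraMap_of_pow_eq q Fq hq this.isFixedPt

variable {q}

/-- If `P` has no root, then the form `a^{q^I} (a^{q^J} + γ b^{q^J}) - αβ b^{q^I} b^{q^J}`
is anisotropic. -/
theorem PHasNoRoot.anisotropic (hq : q ≠ 0) {α β γ : Fqn} {I J : ℕ}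
    (hP : PHasNoRoot q α β γ I J) {a b : Fqn}
    (h : a ^ q ^ I * (a ^ q ^ J + γ * b ^ q ^ J) = α * β * b ^ q ^ I * b ^ q ^ J) :
    a = 0 ∧ b = 0 := by
  have hb : b = 0 := by
    by_contra hb
    have hbI : b ^ q ^ I ≠ 0 := pow_ne_zero _ hb
    have hbJ : b ^ q ^ J ≠ 0 := pow_ne_zero _ hb
    have hz : (a / b) ^ q ^ I * ((a / b) ^ q ^ J + γ) = α * β := by
      rw [div_pow, div_pow]
      field_simp
      linear_combination h
    unfold PHasNoRoot at hP
    split_ifs at hP with hIJ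
    · refine hP ((a / b) ^ q ^ I) ?_
      rw [pow_succ, ← pow_mul, ← pow_add q, Nat.add_sub_cancel' hIJ.le]
      linear_combination hz
    · refine hP ((a / b) ^ q ^ J) ?_
      rw [pow_succ, ← pow_mul, ← pow_add q, Nat.add_sub_cancel' (not_lt.1 hIJ)]
      linear_combination hz
  refine ⟨?_, hb⟩
  subst hb
  simpa [zero_pow (pow_ne_zero _ hq), hq] using h

theorem exists_algebraMap_of_smul_mem_Uspace [FiniteDimensional Fq Fqn]
    (hq : Fintype.card Fq = q) {α β γ : Fqn} (hα : α ≠ 0) (hβ : β ≠ 0) {I J : ℕ}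
    (hgcd : Nat.gcd (Nat.gcd I J) (finrank Fq Fqn) = 1) (hP : PHasNoRoot q α β γ I J)
    {w : Fin 4 → Fqn} (hw0 : w ≠ 0) {c : Fqn} (hw : w ∈ Uspace q Fq hq α β γ I J)
    (hcw : c • w ∈ Uspace q Fq hq α β γ I J) : ∃ d : Fq, algebraMap Fq Fqn d = c := by
  have hq0 : q ≠ 0 := hq ▸ Fintype.card_ne_zero
  obtain ⟨x, y, rfl⟩ := hw
  obtain ⟨x', y', h⟩ := hcw
  have h0 : c * x = x' := by simpa [Uvec] using congrFun h 0
  have h1 : c * y = y' := by simpa [Uvec] using congrFun h 1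
  subst h0 h1
  have h2 := congrFun h 2
  have h3 := congrFun h 3
  simp only [Uvec, Pi.smul_apply, smul_eq_mul, Matrix.cons_val, mul_pow] at h2 h3
  have hxy : ¬ (x = 0 ∧ y = 0) := by
    rintro ⟨rfl, rfl⟩
    refine hw0 (funext fun i => ?_)
    fin_cases i <;> simp [Uvec, hq0]
  have hA : (c ^ q ^ I - c) * x ^ q ^ I = -(α * ((c ^ q ^ J - c) * y ^ q ^ J)) := by
    linear_combination -h2
  have hB : (c ^ q ^ J - c) * (x ^ q ^ J + γ * y ^ q ^ J)
      = -(β * ((c ^ q ^ I - c) * y ^ q ^ I)) := by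
    linear_combination -h3
  by_cases hcI : c ^ q ^ I - c = 0
  · by_cases hcJ : c ^ q ^ J - c = 0
    · exact mem_range_algebraMap_of_gcd q Fq hq hgcd (sub_eq_zero.1 hcI) (sub_eq_zero.1 hcJ)
    · rw [hcI] at hA hB
      have hy : y = 0 := by simpa [hα, hcJ, hq0] using hA
      subst hy
      have hx : x = 0 := by simpa [hcJ, hq0] using hB
      exact absurd ⟨hx, rfl⟩ hxy
  · by_cases hcJ : c ^ q ^ J - c = 0
    · rw [hcJ] at hA hB
      have hx : x = 0 := by simpa [hcI, hq0] using hA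
      have hy : y = 0 := by simpa [hβ, hcI, hq0] using hB
      exact absurd ⟨hx, hy⟩ hxy
    · refine absurd (hP.anisotropic hq0 ?_) hxy
      refine mul_left_cancel₀ (mul_ne_zero hcI hcJ) ?_
      linear_combination (c ^ q ^ J - c) * (x ^ q ^ J + γ * y ^ q ^ J) * hA
        - α * (c ^ q ^ J - c) * y ^ q ^ J * hB

theorem isScattered_Uspace [FiniteDimensional Fq Fqn]
    (hq : Fintype.card Fq = q) {α β γ : Fqn} (hα : α ≠ 0) (hβ : β ≠ 0) {I J : ℕ}
    (hgcd : Nat.gcd (Nat.gcd I J) (finrank Fq Fqn) = 1) (hP : PHasNoRoot q α β γ I J) :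
    IsScattered Fq (Uspace q Fq hq α β γ I J) := by
  intro H hH
  by_cases hbot : Uspace q Fq hq α β γ I J ⊓ H.restrictScalars Fq = ⊥
  · rw [hbot, finrank_bot]
    exact zero_le_one
  obtain ⟨w, ⟨hwU, hwH⟩, hw0⟩ := Submodule.exists_mem_ne_zero_of_ne_bot hbot
  refine finrank_le_one ⟨w, hwU, hwH⟩ ?_
  rintro ⟨v, hvU, hvH⟩
  obtain ⟨c, hc⟩ := (finrank_eq_one_iff_of_nonzero' (⟨w, hwH⟩ : H)
    (by simpa [Subtype.ext_iff] using hw0)).1 hH ⟨v, hvH⟩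
  have hcw : c • w = v := congrArg Subtype.val hc
  subst hcw
  obtain ⟨d, rfl⟩ := exists_algebraMap_of_smul_mem_Uspace Fq hq hα hβ hgcd hP hw0 hwU hvU
  exact ⟨d, Subtype.ext (by simp)⟩

/-- A pair of `2 × 2` blocks `(P, Q)`, `(R, S)` mapping the graph of `u ↦ A u^{q^I} + B u^{q^J}`
into itself is block diagonal, and its blocks are intertwined by `A` and `B`. -/
theorem blocks_of_graph_invariant [FiniteDimensional Fq Fqn] (hq : Fintype.card Fq = q)
    {I J : ℕ} (hI : 0 < I) (hJ : 0 < J) (hIJ : I ≠ J)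
    (hmax : 2 * max I J < finrank Fq Fqn) {m : Type*} [Fintype m] [DecidableEq m]
    {A B P Q R S : Matrix m m Fqn} (hA : IsUnit A) (hB : IsUnit B)
    (h : ∀ u : m → Fqn, R *ᵥ u + S *ᵥ (A *ᵥ frobVec q I u + B *ᵥ frobVec q J u)
      = A *ᵥ frobVec q I (P *ᵥ u + Q *ᵥ (A *ᵥ frobVec q I u + B *ᵥ frobVec q J u))
      + B *ᵥ frobVec q J (P *ᵥ u + Q *ᵥ (A *ᵥ frobVec q I u + B *ᵥ frobVec q J u))) :
    Q = 0 ∧ R = 0 ∧ S * A = A * P.map (frobHom q Fq hq I) ∧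
      S * B = B * P.map (frobHom q Fq hq J) := by
  have hmapunit : ∀ t {M : Matrix m m Fqn}, IsUnit M → IsUnit (M.map (frobHom q Fq hq t)) :=
    fun t M hM => hM.map (frobHom q Fq hq t).mapMatrix
  have key := sum_matrix_coeff_eq_zero q Fq hq ![0, I, J, I + I, I + J, J + J]
    (fun i => by fin_cases i <;> simp <;> omega)
    ![R, S * A - A * P.map (frobHom q Fq hq I), S * B - B * P.map (frobHom q Fq hq J),
      -(A * Q.map (frobHom q Fq hq I) * A.map (frobHom q Fq hq I)),
      -(A * Q.map (frobHom q Fq hq I) * B.map (frobHom q Fq hq I)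
        + B * Q.map (frobHom q Fq hq J) * A.map (frobHom q Fq hq J)),
      -(B * Q.map (frobHom q Fq hq J) * B.map (frobHom q Fq hq J))]
    (fun u => by
      have hu := h u
      simp only [frobVec_add q Fq _ hq, frobVec_mulVec q Fq _ hq, frobVec_frobVec,
        mulVec_add, mulVec_mulVec, Matrix.map_mul, ← mul_assoc, add_comm J I] at hu
      simp only [Fin.sum_univ_succ, Matrix.cons_val_zero, Matrix.cons_val_succ,
        Fin.sum_univ_zero, sub_mulVec, add_mulVec, neg_mulVec, frobVec_zero_exp]
      rw [← sub_eq_zero] at hu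
      refine Eq.trans ?_ hu
      abel)
  simp only [Fin.sum_univ_succ, Matrix.cons_val_zero, Matrix.cons_val_succ,
    Fin.sum_univ_zero] at key
  have hQ : Q = 0 := by
    rcases lt_or_gt_of_ne hIJ with hlt | hlt
    · have h2 := key (J + J)
      simp (disch := omega) only [Pi.single_eq_same, Pi.single_eq_of_ne, zero_add, add_zero, neg_eq_zero] at h2
      rw [(hmapunit J hB).mul_left_eq_zero, hB.mul_right_eq_zero] at h2
      exact map_frobHom_eq_zero q Fq hq J h2
    · have h2 := key (I + I)
      simp (disch := omega) only [Pi.single_eq_same, Pi.single_eq_of_ne, zero_add, add_zero, neg_eq_zero] at h2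
      rw [(hmapunit I hA).mul_left_eq_zero, hA.mul_right_eq_zero] at h2
      exact map_frobHom_eq_zero q Fq hq I h2
  subst hQ
  simp only [Matrix.map_zero _ (map_zero _), mul_zero, zero_mul, neg_zero, add_zero,
    Pi.single_zero, Pi.zero_apply] at key
  refine ⟨rfl, ?_, ?_, ?_⟩
  · have h2 := key 0
    simpa (disch := omega) only [Pi.single_eq_same, Pi.single_eq_of_ne, add_zero] using h2
  · have h2 := key I
    simpa (disch := omega) only [Pi.single_eq_same, Pi.single_eq_of_ne, zero_add, add_zero, sub_eq_zero] using h2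
  · have h2 := key J
    simpa (disch := omega) only [Pi.single_eq_same, Pi.single_eq_of_ne, zero_add, add_zero, sub_eq_zero] using h2

/-- The only `F_{q^n}`-linear idempotents preserving `U` are `0` and `1`. -/
theorem idempotent_eq_zero_or_one_of_Uspace_invariant [FiniteDimensional Fq Fqn]
    (hq : Fintype.card Fq = q) {α β γ : Fqn} (hα : α ≠ 0) (hβ : β ≠ 0)
    {I J : ℕ} (hI : 0 < I) (hJ : 0 < J) (hIJ : I ≠ J)
    (hmax : 2 * max I J < finrank Fq Fqn) (hP : PHasNoRoot q α β γ I J)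
    {M : Matrix (Fin 4) (Fin 4) Fqn} (hM : IsIdempotentElem M)
    (hU : ∀ w ∈ Uspace q Fq hq α β γ I J, M *ᵥ w ∈ Uspace q Fq hq α β γ I J) :
    M = 0 ∨ M = 1 := by
  have hq0 : q ≠ 0 := hq ▸ Fintype.card_ne_zero
  let A : Matrix (Fin 2) (Fin 2) Fqn := !![1, 0; 0, β]
  let B : Matrix (Fin 2) (Fin 2) Fqn := !![0, α; 1, γ]
  let P : Matrix (Fin 2) (Fin 2) Fqn := !![M 0 0, M 0 1; M 1 0, M 1 1]
  let Q : Matrix (Fin 2) (Fin 2) Fqn := !![M 0 2, M 0 3; M 1 2, M 1 3]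
  let R : Matrix (Fin 2) (Fin 2) Fqn := !![M 2 0, M 2 1; M 3 0, M 3 1]
  let S : Matrix (Fin 2) (Fin 2) Fqn := !![M 2 2, M 2 3; M 3 2, M 3 3]
  have hA : IsUnit A := (Matrix.isUnit_iff_isUnit_det A).2 (by simp [A, det_fin_two, hβ])
  have hB : IsUnit B := (Matrix.isUnit_iff_isUnit_det B).2 (by simp [B, det_fin_two, hα])
  obtain ⟨hQ, hR, hSA, hSB⟩ := blocks_of_graph_invariant Fq hq hI hJ hIJ hmax
    (P := P) (Q := Q) (R := R) (S := S) hA hB (fun u => by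
      obtain ⟨x', y', h⟩ := hU _ ⟨u 0, u 1, rfl⟩
      have h0 := congrFun h 0
      have h1 := congrFun h 1
      have h2 := congrFun h 2
      have h3 := congrFun h 3
      simp only [Uvec, mulVec, dotProduct, Fin.sum_univ_four, Matrix.cons_val] at h0 h1 h2 h3
      have hx : (P *ᵥ u + Q *ᵥ (A *ᵥ frobVec q I u + B *ᵥ frobVec q J u)) = ![x', y'] := by
        funext i
        fin_cases i
        · simp [P, Q, A, B, frobVec, dotProduct, Fin.sum_univ_two]
          linear_combination h0
        · simp [P, Q, A, B, frobVec, dotProduct, Fin.sum_univ_two]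
          linear_combination h1
      rw [hx]
      funext i
      fin_cases i
      · simp [R, S, A, B, frobVec, dotProduct, Fin.sum_univ_two]
        linear_combination h2
      · simp [R, S, A, B, frobVec, dotProduct, Fin.sum_univ_two]
        linear_combination h3)
  have hM_of : ∀ T : Matrix (Fin 4) (Fin 4) Fqn, P = !![T 0 0, T 0 1; T 1 0, T 1 1] →
      Q = !![T 0 2, T 0 3; T 1 2, T 1 3] → R = !![T 2 0, T 2 1; T 3 0, T 3 1] →
      S = !![T 2 2, T 2 3; T 3 2, T 3 3] → M = T := by
    intro T hPT hQT hRT hST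
    have e := fun (i j : Fin 2) => And.intro (congrFun (congrFun hPT i) j)
      (And.intro (congrFun (congrFun hQT i) j)
      (And.intro (congrFun (congrFun hRT i) j) (congrFun (congrFun hST i) j)))
    have e00 := e 0 0
    have e01 := e 0 1
    have e10 := e 1 0
    have e11 := e 1 1
    simp [P, Q, R, S] at e00 e01 e10 e11
    ext i j
    fin_cases i <;> fin_cases j <;> simp [*]
  by_cases hdet : P.det = 0
  · left
    have hS : S = 0 := by
      obtain ⟨w, hw0, hw⟩ := Matrix.exists_mulVec_eq_zero_iff.2 hdet
      have hker : ∀ t, P.map (frobHom q Fq hq t) *ᵥ frobVec q t w = 0 := fun t => by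
        rw [← frobVec_mulVec, hw, frobVec_zero q Fq t hq]
      let a := A *ᵥ frobVec q I w
      let b := B *ᵥ frobVec q J w
      have ha : S *ᵥ a = 0 := by
        rw [mulVec_mulVec, hSA, ← mulVec_mulVec, hker, mulVec_zero]
      have hb : S *ᵥ b = 0 := by
        rw [mulVec_mulVec, hSB, ← mulVec_mulVec, hker, mulVec_zero]
      let N : Matrix (Fin 2) (Fin 2) Fqn := !![a 0, b 0; a 1, b 1]
      have hN : IsUnit N := by
        rw [Matrix.isUnit_iff_isUnit_det, isUnit_iff_ne_zero]
        intro hNdet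
        obtain ⟨hw₁, hw₂⟩ := hP.anisotropic hq0 (a := w 0) (b := w 1) (by
          simp [N, a, b, A, B, det_fin_two, frobVec, dotProduct,
            Fin.sum_univ_two] at hNdet
          linear_combination hNdet)
        exact hw0 (funext fun i => by fin_cases i <;> assumption)
      rw [← hN.mul_left_eq_zero (a := S)]
      ext i j
      have hai := congrFun ha i
      have hbi := congrFun hb i
      simp only [mulVec, dotProduct, Fin.sum_univ_two, Pi.zero_apply] at hai hbi
      fin_cases j <;> simpa [N, Matrix.mul_apply, Fin.sum_univ_two]
    have hP0 : P = 0 := by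
      rw [hS, zero_mul, eq_comm, hA.mul_right_eq_zero] at hSA
      exact map_frobHom_eq_zero q Fq hq I hSA
    refine hM_of 0 ?_ ?_ ?_ ?_
    all_goals
      first | rw [hP0] | rw [hQ] | rw [hR] | rw [hS]
      ext i j
      fin_cases i <;> fin_cases j <;> rfl
  · right
    have hPunit : IsUnit P := (Matrix.isUnit_iff_isUnit_det P).2 (isUnit_iff_ne_zero.2 hdet)
    have hPP : P * P = P := by
      have hMM := fun i j => congrFun (congrFun hM i) j
      have hQ' := fun i j => congrFun (congrFun hQ i) j
      have q00 : M 0 2 = 0 := hQ' 0 0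
      have q01 : M 0 3 = 0 := hQ' 0 1
      have q10 : M 1 2 = 0 := hQ' 1 0
      have q11 : M 1 3 = 0 := hQ' 1 1
      have m00 := hMM 0 0
      have m01 := hMM 0 1
      have m10 := hMM 1 0
      have m11 := hMM 1 1
      simp only [Matrix.mul_apply, Fin.sum_univ_four, q00, q01, q10, q11, zero_mul,
        add_zero] at m00 m01 m10 m11
      ext i j
      fin_cases i <;> fin_cases j <;> simpa [P, Matrix.mul_apply, Fin.sum_univ_two]
    have hP1 : P = 1 := hPunit.mul_left_cancel (by rw [hPP, mul_one])
    have hS1 : S = 1 := hA.mul_right_cancel (by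
      rw [hSA, hP1, Matrix.map_one _ (map_zero _) (map_one _), mul_one, one_mul])
    refine hM_of 1 ?_ ?_ ?_ ?_
    all_goals
      first | rw [hP1] | rw [hQ] | rw [hR] | rw [hS1]
      ext i j
      fin_cases i <;> fin_cases j <;> rfl

end ScatteredSeq

open ScatteredSeq Module

/-- Assume gcd(I,J,n) = 1, that P^{I,J}_{α,β,γ}(X) has no roots in
F_{q^n}, and max{I,J} ≤ (n−1)/2.  Then U := U^{I,J,n}_{α,β,γ} is scattered and
indecomposable: there are no nonzero F_{q^n}-subspaces V₁, V₂ of F_{q^n}^4 with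
F_{q^n}^4 = V₁ ⊕ V₂, U = (U ∩ V₁) + (U ∩ V₂), and dim_{F_q}(U ∩ Vᵢ) positive
multiples of n. -/
theorem Uspace_scattered_and_indecomposable
    (q n : ℕ) (Fq Fqn : Type*) [Field Fq] [Fintype Fq] [Field Fqn] [Algebra Fq Fqn]
    (hq : Fintype.card Fq = q) (hrank : Module.finrank Fq Fqn = n)
    (α β γ : Fqn) (hα : α ≠ 0) (hβ : β ≠ 0) (hγ : γ ≠ 0)
    (I J : ℕ) (hI : 0 < I) (hJ : 0 < J) (hIJ : I ≠ J) (hIn : I < n - 1) (hJn : J < n - 1)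
    (hgcd : Nat.gcd (Nat.gcd I J) n = 1)
    (hP : PHasNoRoot q α β γ I J)
    (hmax : 2 * max I J ≤ n - 1) :
    IsScattered Fq (Uspace q Fq hq α β γ I J) ∧
    ¬ ∃ V₁ V₂ : Submodule Fqn (Fin 4 → Fqn),
        V₁ ≠ ⊥ ∧ V₂ ≠ ⊥ ∧ IsCompl V₁ V₂ ∧
        Uspace q Fq hq α β γ I J
          = Uspace q Fq hq α β γ I J ⊓ V₁.restrictScalars Fq
            ⊔ Uspace q Fq hq α β γ I J ⊓ V₂.restrictScalars Fq ∧
        (∃ a : ℕ, 0 < a ∧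
          Module.finrank Fq ↥(Uspace q Fq hq α β γ I J ⊓ V₁.restrictScalars Fq) = a * n) ∧
        (∃ b : ℕ, 0 < b ∧
          Module.finrank Fq ↥(Uspace q Fq hq α β γ I J ⊓ V₂.restrictScalars Fq) = b * n) := by
  subst hrank
  have hpos : 0 < finrank Fq Fqn := by omega
  have : FiniteDimensional Fq Fqn := FiniteDimensional.of_finrank_pos hpos
  refine ⟨isScattered_Uspace Fq hq hα hβ hgcd hP, ?_⟩
  rintro ⟨V₁, V₂, hV₁, hV₂, hV, hU, -, -⟩
  have hidem : IsIdempotentElem (LinearMap.toMatrix' (V₁.projection V₂ hV)) := by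
    rw [IsIdempotentElem, ← LinearMap.toMatrix'_mul, (Submodule.isIdempotentElem_projection hV).eq]
  rcases idempotent_eq_zero_or_one_of_Uspace_invariant Fq hq hα hβ hI hJ hIJ (by omega) hP
    hidem (fun w hw => by
      rw [LinearMap.toMatrix'_mulVec]
      rw [hU] at hw
      obtain ⟨v₁, ⟨hv₁U, hv₁⟩, v₂, ⟨-, hv₂⟩, rfl⟩ := Submodule.mem_sup.1 hw
      rw [map_add, Submodule.projection_apply_of_mem_left hV hv₁,
        (Submodule.projection_apply_eq_zero_iff hV).2 hv₂, add_zero]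
      exact hv₁U) with h | h
  · refine hV₁ ?_
    rw [← Submodule.range_projection hV, LinearMap.range_eq_bot]
    simpa using h
  · refine hV₂ ?_
    rw [← Submodule.ker_projection hV, LinearMap.ker_eq_bot']
    intro v hv
    rwa [← LinearMap.toMatrix'_mulVec, h, Matrix.one_mulVec] at hv
end

section
/- Let h₁, h₂, g₁, g₂ : F_{q^n} → F_{q^n} be F_q-linear maps and let h₁^⊤, h₂^⊤, g₁^⊤, g₂^⊤ : F_{q^n} → F_{q^n} be F_q-linear maps satisfying the adjoint identities Tr_{q^n/q}(x·f(y)) = Tr_{q^n/q}(y·f^⊤(x)) for all x, y ∈ F_{q^n}, for each f ∈ {h₁, h₂, g₁, g₂}. Let X := {(x, y, h₁(x) + h₂(y), g₁(x) + g₂(y)) : x, y ∈ F_{q^n}} ⊆ F_{q^n}^4. Then the orthogonal complement of X with respect to the F_q-bilinear form B((x₀,x₁,x₂,x₃),(y₀,y₁,y₂,y₃)) := Tr_{q^n/q}(x₀y₃ + x₃y₀ − x₁y₂ − x₂y₁) equals {(x, y, g₂^⊤(x) − h₂^⊤(y), h₁^⊤(y) − g₁^⊤(x)) : x, y ∈ F_{q^n}}.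 -/
/-- Let `h₁, h₂, g₁, g₂ : F_{q^n} → F_{q^n}` be `F_q`-linear maps
with adjoints `h₁^⊤, h₂^⊤, g₁^⊤, g₂^⊤` with respect to the bilinear form
`Tr_{q^n/q}(xy)`, and let
`X = {(x, y, h₁(x) + h₂(y), g₁(x) + g₂(y)) : x, y ∈ F_{q^n}}`.  Then the orthogonal
complement of `X` with respect to the `F_q`-bilinear form
`B(x, y) = Tr_{q^n/q}(x₀y₃ + x₃y₀ − x₁y₂ − x₂y₁)` is
`{(x, y, g₂^⊤(x) − h₂^⊤(y), h₁^⊤(y) − g₁^⊤(x)) : x, y ∈ F_{q^n}}`. -/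
theorem orthogonal_complement_of_graph_subspace
    (q n : ℕ) (hn : 0 < n)
    (Fq Fqn : Type*) [Field Fq] [Fintype Fq] [Field Fqn] [Algebra Fq Fqn]
    (hq : Fintype.card Fq = q) (hrank : Module.finrank Fq Fqn = n)
    (h₁ h₂ g₁ g₂ h₁t h₂t g₁t g₂t : Fqn →ₗ[Fq] Fqn)
    (hh₁ : ∀ x y : Fqn, Algebra.trace Fq Fqn (x * h₁ y) = Algebra.trace Fq Fqn (y * h₁t x))
    (hh₂ : ∀ x y : Fqn, Algebra.trace Fq Fqn (x * h₂ y) = Algebra.trace Fq Fqn (y * h₂t x))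
    (hg₁ : ∀ x y : Fqn, Algebra.trace Fq Fqn (x * g₁ y) = Algebra.trace Fq Fqn (y * g₁t x))
    (hg₂ : ∀ x y : Fqn, Algebra.trace Fq Fqn (x * g₂ y) = Algebra.trace Fq Fqn (y * g₂t x)) :
    {v : Fin 4 → Fqn |
        ∀ u ∈ {w : Fin 4 → Fqn | ∃ x y : Fqn, w = ![x, y, h₁ x + h₂ y, g₁ x + g₂ y]},
          Algebra.trace Fq Fqn (u 0 * v 3 + u 3 * v 0 - u 1 * v 2 - u 2 * v 1) = 0}
      = {w : Fin 4 → Fqn | ∃ x y : Fqn, w = ![x, y, g₂t x - h₂t y, h₁t y - g₁t x]} := by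
  have : FiniteDimensional Fq Fqn := Module.finite_of_finrank_pos (hrank ▸ hn)
  have key : ∀ (x y : Fqn) (v : Fin 4 → Fqn),
      Algebra.trace Fq Fqn (x * v 3 + (g₁ x + g₂ y) * v 0 - y * v 2 - (h₁ x + h₂ y) * v 1) =
        Algebra.trace Fq Fqn (x * (v 3 - (h₁t (v 1) - g₁t (v 0)))) -
          Algebra.trace Fq Fqn (y * (v 2 - (g₂t (v 0) - h₂t (v 1)))) := by
    intro x y v
    simp only [mul_add, mul_sub, map_add, map_sub, mul_comm _ (v 0), mul_comm _ (v 1),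
      hh₁, hh₂, hg₁, hg₂]
    ring
  have eq_zero : ∀ a : Fqn, (∀ x : Fqn, Algebra.trace Fq Fqn (x * a) = 0) → a = 0 :=
    fun a ha => (traceForm_nondegenerate Fq Fqn).2 a ha
  ext v
  constructor
  · intro hv
    have hv' : ∀ x y : Fqn, Algebra.trace Fq Fqn (x * (v 3 - (h₁t (v 1) - g₁t (v 0)))) -
        Algebra.trace Fq Fqn (y * (v 2 - (g₂t (v 0) - h₂t (v 1)))) = 0 := fun x y =>
      (key x y v).symm.trans (hv _ ⟨x, y, rfl⟩)
    have h3 := sub_eq_zero.mp (eq_zero _ fun x => by simpa using hv' x 0)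
    have h2 := sub_eq_zero.mp (eq_zero _ fun y => by simpa using hv' 0 y)
    refine ⟨v 0, v 1, ?_⟩
    rw [← h2, ← h3]
    ext i
    fin_cases i <;> rfl
  · rintro ⟨a, b, rfl⟩ _ ⟨x, y, rfl⟩
    exact (key x y _).trans (by simp)
end
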